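/- arXiv:2509.01578 — 10 statements merged into one kernel-verified Lean document; each statement's English description precedes it below -/
import Mathlib

section
/- Let (H, ⟨-,-,-⟩, α) be a Hom-heap and let e ∈ H satisfy α(e) = e. Define a binary operation on H by a •ₑ b = ⟨a, e, b⟩. Then (H, •ₑ, e, α) is a Hom-group: α(a) •ₑ (b •ₑ c) = (a •ₑ b) •ₑ α(c), α(a •ₑ b) = α(a) •ₑ α(b), a •ₑ e = e •ₑ a = α(a), and every a ∈ H has the inverse a⁻¹ = ⟨e, α⁻¹(a), e⟩ satisfying a •ₑ a⁻¹ = a⁻¹ •ₑ a = e. -/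
/-- A Hom-heap: a set `H` with a bijective map `α` and a ternary operation `t`
satisfying the Hom-Mal'cev identities, Hom-associativity, and compatibility with `α`. -/
def IsHomHeap {H : Type*} (t : H → H → H → H) (α : H ≃ H) : Prop :=
  (∀ x y, t x x y = α y) ∧
  (∀ x y, t y x x = α y) ∧
  (∀ e f x y z, t (α e) (α f) (t x y z) = t (t e f x) (α y) (α z)) ∧
  (∀ x y z, α (t x y z) = t (α x) (α y) (α z))

/-- Retracting a Hom-heap at a fixed point `e` of `α` (via `a •ₑ b = ⟨a,e,b⟩`)
yields a Hom-group with unit `e` and inverses `a⁻¹ = ⟨e, α⁻¹(a), e⟩`. -/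
theorem stmt_1 {H : Type*} (t : H → H → H → H) (α : H ≃ H)
    (h : IsHomHeap t α) (e : H) (he : α e = e) :
    (∀ a b c, t (α a) e (t b e c) = t (t a e b) e (α c)) ∧
    (∀ a b, α (t a e b) = t (α a) e (α b)) ∧
    (∀ a, t a e e = α a) ∧
    (∀ a, t e e a = α a) ∧
    (∀ a, t a e (t e (α.symm a) e) = e ∧ t (t e (α.symm a) e) e a = e) := by
  obtain ⟨hl, hr, hassoc, hcomp⟩ := h
  have hassoc' (a b x c : H) : t (α a) (α b) (t x e c) = t (t a b x) e (α c) := by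
    simpa only [he] using hassoc a b x e c
  refine ⟨fun a b c => ?_, fun a b => ?_, fun a => hr e a, fun a => hl e a, fun a => ?_⟩
  · simpa only [he] using hassoc' a e b c
  · rw [hcomp, he]
  · obtain ⟨b, rfl⟩ := α.surjective a
    rw [α.symm_apply_apply]
    constructor
    · have key := hassoc b e e b e
      rwa [hr, hl, he, he] at key
    · rw [← hassoc', hl, hr, he, he]
end

section
/- Let (H, •, 1, α) be a Hom-group. Define a ternary operation on H by ⟨a, b, c⟩ = a • (α⁻¹(b⁻¹) • α⁻¹(c)). Then (H, ⟨-,-,-⟩, α) is a Hom-heap: for all e, f, x, y, z ∈ H one has ⟨x,x,y⟩ = α(y) = ⟨y,x,x⟩, ⟨α(e), α(f), ⟨x,y,z⟩⟩ = ⟨⟨e,f,x⟩, α(y), α(z)⟩, and α(⟨x,y,z⟩) = ⟨α(x), α(y), α(z)⟩. -/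
/-- A (regular) Hom-group: a set `G` with a distinguished element `e`, a bijective
map `α`, a binary operation `mul`, and an inverse map `inv`, satisfying twisted
associativity, multiplicativity of `α`, twisted unitality, and invertibility. -/
def IsHomGroup {G : Type*} (mul : G → G → G) (e : G) (inv : G → G) (α : G ≃ G) : Prop :=
  (∀ a b c, mul (α a) (mul b c) = mul (mul a b) (α c)) ∧
  (∀ a b, α (mul a b) = mul (α a) (α b)) ∧
  (∀ a, mul a e = α a) ∧
  (∀ a, mul e a = α a) ∧
  (∀ a, mul a (inv a) = e) ∧
  (∀ a, mul (inv a) a = e)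

namespace IsHomGroup

variable {G : Type*} {mul : G → G → G} {e : G} {inv : G → G} {α : G ≃ G}

theorem map_unit (h : IsHomGroup mul e inv α) : α e = e := by
  obtain ⟨-, hmul, hr, hl, -, -⟩ := h
  have hunit : mul e (α e) = α e := by
    have hm := hmul (α.symm e) e
    rw [hr, α.apply_symm_apply] at hm
    exact hm.symm
  exact α.injective ((hl (α e)).symm.trans hunit)

/-- Untwisting the product of a Hom-group by `α⁻¹` yields a group. -/
abbrev untwist (h : IsHomGroup mul e inv α) : Group G :=
  letI : Mul G := ⟨fun a b => α.symm (mul a b)⟩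
  letI : Inv G := ⟨inv⟩
  letI : One G := ⟨e⟩
  Group.ofLeftAxioms
    (fun a b c => by
      change α.symm (mul (α.symm (mul a b)) c) = α.symm (mul a (α.symm (mul b c)))
      apply congrArg α.symm
      apply α.injective
      rw [h.2.1, h.2.1, α.apply_symm_apply, α.apply_symm_apply, h.1])
    (fun a => by
      change α.symm (mul e a) = a
      rw [h.2.2.2.1, α.symm_apply_apply])
    (fun a => by
      change α.symm (mul (inv a) a) = e
      rw [h.2.2.2.2.2, α.symm_apply_eq, h.map_unit])

end IsHomGroup

/-- From a Hom-group `(H, •, 1, α)` the ternary operation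
`⟨a,b,c⟩ = a • (α⁻¹(b⁻¹) • α⁻¹(c))` makes `(H, ⟨-,-,-⟩, α)` a Hom-heap. -/
theorem stmt_2 {H : Type*} (mul : H → H → H) (one : H) (inv : H → H) (α : H ≃ H)
    (h : IsHomGroup mul one inv α) :
    (∀ x y, mul x (mul (α.symm (inv x)) (α.symm y)) = α y) ∧
    (∀ x y, mul y (mul (α.symm (inv x)) (α.symm x)) = α y) ∧
    (∀ e f x y z,
      mul (α e) (mul (α.symm (inv (α f)))
        (α.symm (mul x (mul (α.symm (inv y)) (α.symm z)))))
      = mul (mul e (mul (α.symm (inv f)) (α.symm x)))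
          (mul (α.symm (inv (α y))) (α.symm (α z)))) ∧
    (∀ x y z, α (mul x (mul (α.symm (inv y)) (α.symm z)))
      = mul (α x) (mul (α.symm (inv (α y))) (α.symm (α z)))) := by
  let : Group H := h.untwist
  have hm (a b : H) : mul a b = α (a * b) := (α.apply_symm_apply _).symm
  have hi (a : H) : inv a = a⁻¹ := rfl
  have hα (a b : H) : α (a * b) = α a * α b := by
    apply α.injective
    rw [← hm (α a), ← h.2.1, hm]
  let φ : H ≃* H := MulEquiv.mk' α hα
  have hφ (a : H) : α a = φ a := rfl
  have hs (a : H) : α.symm a = φ.symm a := rfl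
  simp only [hm, hi, hφ, hs]
  refine ⟨?_, ?_, ?_, ?_⟩ <;> intros <;> simp [mul_assoc]
end

section
/- Let (T, ⟨-,-,-⟩, •, α, β) be a tuple where (T, ⟨-,-,-⟩, α) is an abelian Hom-heap, α is multiplicative (α(a•b) = α(a)•α(b)), β : T → T is bijective, and the following identities hold for all a, b, c, d ∈ T: β(a)•(b•c) = (a•b)•β(c); α(a)•⟨b,c,d⟩ = ⟨a•b, a•c, a•d⟩; there is 1 ∈ T with a•1 = 1•a = β(a); and α(1) = β(1) = 1. Then β is an endomorphism of the abelian Hom-heap (T, ⟨-,-,-⟩, α), i.e. β(⟨a,b,c⟩) = ⟨β(a), β(b), β(c)⟩ and α ∘ β = β ∘ α, and β is multiplicative, i.e. β(a•b) = β(a)•β(b). -/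
/-- An abelian Hom-heap: a Hom-heap whose ternary operation satisfies
`⟨a,b,c⟩ = ⟨c,b,a⟩`. -/
def IsAbelianHomHeap {H : Type*} (t : H → H → H → H) (α : H ≃ H) : Prop :=
  (∀ x y, t x x y = α y) ∧
  (∀ x y, t y x x = α y) ∧
  (∀ e f x y z, t (α e) (α f) (t x y z) = t (t e f x) (α y) (α z)) ∧
  (∀ x y z, α (t x y z) = t (α x) (α y) (α z)) ∧
  (∀ a b c, t a b c = t c b a)

/-- If `(T, ⟨-,-,-⟩, α)` is an abelian Hom-heap, `α` is multiplicative, `β` is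
bijective, and the Hom-associativity, left Hom-distributivity and unitality
identities hold, then `β` is an endomorphism of the abelian Hom-heap (it
preserves the ternary operation and commutes with `α`) and is multiplicative. -/
theorem stmt_5 {T : Type*} (t : T → T → T → T) (mul : T → T → T) (α : T ≃ T)
    (β : T → T) (hβ : Function.Bijective β)
    (hheap : IsAbelianHomHeap t α)
    (hαmul : ∀ a b, α (mul a b) = mul (α a) (α b))
    (hassoc : ∀ a b c, mul (β a) (mul b c) = mul (mul a b) (β c))
    (hdist : ∀ a b c d, mul (α a) (t b c d) = t (mul a b) (mul a c) (mul a d))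
    (one : T)
    (hunit : ∀ a, mul a one = β a ∧ mul one a = β a)
    (hone : α one = one ∧ β one = one) :
    (∀ a b c, β (t a b c) = t (β a) (β b) (β c)) ∧
    (∀ a, α (β a) = β (α a)) ∧
    (∀ a b, β (mul a b) = mul (β a) (β b)) := by
  obtain ⟨hα1, hβ1⟩ := hone
  have one_mul' : ∀ a, mul one a = β a := fun a => (hunit a).2
  have mul_one' : ∀ a, mul a one = β a := fun a => (hunit a).1
  refine ⟨fun a b c => ?_, fun a => ?_, fun a b => ?_⟩
  · simpa only [hα1, one_mul'] using hdist one a b c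
  · simpa only [hα1, mul_one'] using hαmul a one
  · simpa only [hβ1, one_mul'] using hassoc one a b
end

section
/- Let (T, ⟨-,-,-⟩, •, α, β) be a Hom-truss of type (2). Then for all a, b, c, d ∈ T: (1) β(a)•(b•c) = (a•b)•α(c); (2) (a•b)•β(c) = β(a)•(b•β(α⁻¹(c))); (3) α(a)•⟨b,c,d⟩ = ⟨a•b, a•c, a•d⟩; (4) ⟨a,b,c⟩•α(d) = ⟨a•d, b•d, c•d⟩. -/
/-- A Hom-truss of type (1). -/
def IsHomTruss1 {T : Type*} (t : T → T → T → T) (mul : T → T → T) (α β : T ≃ T) : Prop :=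
  IsAbelianHomHeap t α ∧
  (∀ x y z, β (t x y z) = t (β x) (β y) (β z)) ∧
  (∀ a, α (β a) = β (α a)) ∧
  (∀ a b, α (mul a b) = mul (α a) (α b)) ∧
  (∀ a b, β (mul a b) = mul (β a) (β b)) ∧
  (∀ a b c, mul (β a) (mul b c) = mul (mul a b) (β c)) ∧
  (∀ a b c d, mul (α a) (t b c d) = t (mul a b) (mul a c) (mul a d)) ∧
  (∀ a b c d, mul (t a b c) (α d) = t (mul a d) (mul b d) (mul c d))

/-- A Hom-truss of type (2). -/
def IsHomTruss2 {T : Type*} (t : T → T → T → T) (mul : T → T → T) (α β : T ≃ T) : Prop :=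
  IsAbelianHomHeap t α ∧
  (∀ x y z, β (t x y z) = t (β x) (β y) (β z)) ∧
  (∀ a, α (β a) = β (α a)) ∧
  (∀ a b, α (mul a b) = mul (α a) (α b)) ∧
  (∀ a b, β (mul a b) = mul (β a) (β b)) ∧
  (∀ a b c, mul (β (α (α a))) (mul (β (α b)) (β (β c)))
    = mul (mul (α (α a)) (β (α b))) (β (β (α c)))) ∧
  (∀ a b c d, mul (α (α a)) (β (t b c d))
    = t (mul (α a) (β b)) (mul (α a) (β c)) (mul (α a) (β d))) ∧
  (∀ a b c d, mul (α (t a b c)) (α (β d))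
    = t (mul (α a) (β d)) (mul (α b) (β d)) (mul (α c) (β d)))

/-- Identities satisfied in any Hom-truss of type (2). -/
theorem stmt_7 {T : Type*} (t : T → T → T → T) (mul : T → T → T) (α β : T ≃ T)
    (h : IsHomTruss2 t mul α β) :
    (∀ a b c, mul (β a) (mul b c) = mul (mul a b) (α c)) ∧
    (∀ a b c, mul (mul a b) (β c) = mul (β a) (mul b (β (α.symm c)))) ∧
    (∀ a b c d, mul (α a) (t b c d) = t (mul a b) (mul a c) (mul a d)) ∧
    (∀ a b c d, mul (t a b c) (α d) = t (mul a d) (mul b d) (mul c d)) := by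
  obtain ⟨⟨-, -, -, hαt, -⟩, hβt, hαβ, -, -, hassoc, hleft, hright⟩ := h
  have assoc : ∀ a b c, mul (β a) (mul b c) = mul (mul a b) (α c) := by
    intro a b c
    simpa [← hαβ] using hassoc (α.symm (α.symm a)) (α.symm (β.symm b)) (β.symm (β.symm c))
  refine ⟨assoc, fun a b c => ?_, fun a b c d => ?_, fun a b c d => ?_⟩
  · simp [assoc, hαβ]
  · simpa [hβt] using hleft (α.symm a) (β.symm b) (β.symm c) (β.symm d)
  · simpa [hαt] using hright (α.symm a) (α.symm b) (α.symm c) (β.symm d)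
end

section
/- Let T be a set with a ternary operation ⟨-,-,-⟩, a binary operation •, and a bijective map α : T → T. Then (T, ⟨-,-,-⟩, •, α, α) is a Hom-truss of type (1) with β = α if and only if (T, ⟨-,-,-⟩, •, α, α) is a Hom-truss of type (2) with β = α. -/
/-- An α-Hom-truss of type (1) is the same as an α-Hom-truss of type (2). -/
theorem stmt_8 {T : Type*} (t : T → T → T → T) (mul : T → T → T) (α : T ≃ T) :
    IsHomTruss1 t mul α α ↔ IsHomTruss2 t mul α α := by
  constructor
  · rintro ⟨hheap, ht, hcomm, hmul, hmul', hassoc, hleft, hright⟩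
    refine ⟨hheap, ht, hcomm, hmul, hmul', fun a b c => hassoc _ _ _, fun a b c d => ?_,
      fun a b c d => ?_⟩
    · rw [ht, hleft]
    · rw [ht, hright]
  · rintro ⟨hheap, ht, hcomm, hmul, hmul', hassoc, hleft, hright⟩
    refine ⟨hheap, ht, hcomm, hmul, hmul', fun a b c => ?_, fun a b c d => ?_,
      fun a b c d => ?_⟩
    · simpa using hassoc (α.symm (α.symm a)) (α.symm (α.symm b)) (α.symm (α.symm c))
    · simpa [ht] using hleft (α.symm a) (α.symm b) (α.symm c) (α.symm d)
    · simpa [ht] using hright (α.symm a) (α.symm b) (α.symm c) (α.symm d)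
end

section
/- Let (T, ⟨-,-,-⟩, •) be a truss and let α, β : T → T be two commuting truss automorphisms. Define ⟨a,b,c⟩* = α(⟨a,b,c⟩) and a •* b = β(a • b). Then (T, ⟨-,-,-⟩*, •*, α, β) is a Hom-truss of type (1). -/
/-- A truss: an abelian heap together with an associative multiplication that
distributes over the ternary operation on both sides. -/
def IsTruss {T : Type*} (t : T → T → T → T) (mul : T → T → T) : Prop :=
  (∀ a b c d e, t (t a b c) d e = t a b (t c d e)) ∧
  (∀ a b, t a a b = b) ∧
  (∀ a b, t b a a = b) ∧
  (∀ a b c, t a b c = t c b a) ∧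
  (∀ a b c, mul (mul a b) c = mul a (mul b c)) ∧
  (∀ a b c d, mul a (t b c d) = t (mul a b) (mul a c) (mul a d)) ∧
  (∀ a b c d, mul (t a b c) d = t (mul a d) (mul b d) (mul c d))

/-- Twisting a truss by two commuting truss automorphisms `α, β` via
`⟨a,b,c⟩* = α(⟨a,b,c⟩)` and `a •* b = β(a • b)` gives a Hom-truss of type (1). -/
theorem stmt_9 {T : Type*} (t : T → T → T → T) (mul : T → T → T) (α β : T ≃ T)
    (htruss : IsTruss t mul)
    (hαt : ∀ a b c, α (t a b c) = t (α a) (α b) (α c))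
    (hαmul : ∀ a b, α (mul a b) = mul (α a) (α b))
    (hβt : ∀ a b c, β (t a b c) = t (β a) (β b) (β c))
    (hβmul : ∀ a b, β (mul a b) = mul (β a) (β b))
    (hcomm : ∀ a, α (β a) = β (α a)) :
    IsHomTruss1 (fun a b c => α (t a b c)) (fun a b => β (mul a b)) α β := by
  obtain ⟨hassoc, hleft, hright, hsymm, hmul, hdistl, hdistr⟩ := htruss
  refine ⟨⟨fun x y => ?_, fun x y => ?_, fun e f x y z => ?_, fun x y z => ?_, fun a b c => ?_⟩,
    fun x y z => ?_, hcomm, fun a b => ?_, fun a b => ?_, fun a b c => ?_, fun a b c d => ?_,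
    fun a b c d => ?_⟩ <;> dsimp only
  · rw [hleft]
  · rw [hright]
  · rw [← hαt, ← hαt, hassoc]
  · rw [← hαt]
  · rw [hsymm]
  · rw [← hcomm, hβt]
  · rw [hcomm, hαmul]
  · rw [← hβmul]
  · rw [← hβmul, ← hβmul, hmul]
  · rw [← hαmul, hdistl, ← hcomm, hβt]
  · rw [← hαmul, hdistr, ← hcomm, hβt]
end

section
/- Let (T, ⟨-,-,-⟩, •, α, β) be a Hom-truss of type (1). Define ⟨a,b,c⟩* = α⁻¹(⟨a,b,c⟩) and a •* b = β⁻¹(a • b). Then (T, ⟨-,-,-⟩*, •*) is a truss. -/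
/-- Untwisting a Hom-truss of type (1) via `⟨a,b,c⟩* = α⁻¹(⟨a,b,c⟩)` and
`a •* b = β⁻¹(a • b)` gives a truss. -/
theorem stmt_10 {T : Type*} (t : T → T → T → T) (mul : T → T → T) (α β : T ≃ T)
    (h : IsHomTruss1 t mul α β) :
    IsTruss (fun a b c => α.symm (t a b c)) (fun a b => β.symm (mul a b)) := by
  obtain ⟨⟨hl, hr, hassoc, hα, hcomm⟩, hβ, hαβ, hαm, hβm, hm, hdl, hdr⟩ := h
  refine ⟨fun a b c d e => ?_, fun a b => ?_, fun a b => ?_, fun a b c => ?_,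
    fun a b c => ?_, fun a b c d => ?_, fun a b c d => ?_⟩
  · apply α.injective
    apply α.injective
    simp [hα, hassoc]
  · simp [hl]
  · simp [hr]
  · simp [hcomm a b c]
  · apply β.injective
    apply β.injective
    simp [hβm, hm]
  · apply β.injective
    apply α.injective
    simp [hαβ, hαm, hβ, hdl]
  · apply β.injective
    apply α.injective
    simp [hαβ, hαm, hβ, hdr]
end

section
/- Let (T, ⟨-,-,-⟩, •, α, β) be a Hom-truss of type (2). Define ⟨a,b,c⟩* = α⁻¹(⟨a,b,c⟩) and a •* b = β⁻¹(a) • α⁻¹(b). Then (T, ⟨-,-,-⟩*, •*) is a truss. -/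
/-- Untwisting a Hom-truss of type (2) via `⟨a,b,c⟩* = α⁻¹(⟨a,b,c⟩)` and
`a •* b = β⁻¹(a) • α⁻¹(b)` gives a truss. -/
theorem stmt_12 {T : Type*} (t : T → T → T → T) (mul : T → T → T) (α β : T ≃ T)
    (h : IsHomTruss2 t mul α β) :
    IsTruss (fun a b c => α.symm (t a b c)) (fun a b => mul (β.symm a) (α.symm b)) := by
  obtain ⟨⟨hl, hr, hassoc, hαt, hcomm⟩, hβt, hαβ, hαm, hβm, hmul, hld, hrd⟩ := h
  have hαt' (x y z) : α.symm (t x y z) = t (α.symm x) (α.symm y) (α.symm z) := by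
    rw [Equiv.symm_apply_eq, hαt]; simp
  have hβt' (x y z) : β.symm (t x y z) = t (β.symm x) (β.symm y) (β.symm z) := by
    rw [Equiv.symm_apply_eq, hβt]; simp
  have hαm' (x y) : α.symm (mul x y) = mul (α.symm x) (α.symm y) := by
    rw [Equiv.symm_apply_eq, hαm]; simp
  have hβm' (x y) : β.symm (mul x y) = mul (β.symm x) (β.symm y) := by
    rw [Equiv.symm_apply_eq, hβm]; simp
  have hαβ' (x) : β (α.symm x) = α.symm (β x) := by
    rw [Equiv.eq_symm_apply, hαβ]; simp
  have hβα' (x) : β.symm (α x) = α (β.symm x) := by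
    rw [Equiv.symm_apply_eq, ← hαβ]; simp
  have hsymm (x) : β.symm (α.symm x) = α.symm (β.symm x) := by
    rw [Equiv.symm_apply_eq, hαβ', Equiv.apply_symm_apply]
  refine ⟨fun a b c d e => ?_, fun a b => ?_, fun a b => ?_, fun a b c => ?_,
    fun a b c => ?_, fun a b c d => ?_, fun a b c d => ?_⟩
  · simpa [hαt'] using
      (hassoc (α.symm (α.symm a)) (α.symm (α.symm b)) (α.symm (α.symm c))
        (α.symm (α.symm d)) (α.symm (α.symm e))).symm
  · simp [hl]
  · simp [hr]
  · simp only [hcomm a b c]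
  · simpa [hαm', hβm', hαβ', hβα', hsymm, ← hαβ] using
      (hmul (α.symm (α.symm (β.symm (β.symm a)))) (α.symm (α.symm (β.symm (β.symm b))))
        (α.symm (α.symm (β.symm (β.symm c))))).symm
  · simpa [hαt', hβt', hαm', hαβ', hβα', hsymm, hβt] using
      hld (α.symm (α.symm (β.symm a))) (α.symm (α.symm (β.symm b)))
        (α.symm (α.symm (β.symm c))) (α.symm (α.symm (β.symm d)))
  · simpa [hαt', hβt', hαm', hαβ', hβα', hsymm, hαt] using
      hrd (α.symm (α.symm (β.symm a))) (α.symm (α.symm (β.symm b)))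
        (α.symm (α.symm (β.symm c))) (α.symm (α.symm (β.symm d)))
end

section
/- Let (B, ★, •, α, β) be a Hom-brace of type (2). Then for all a, b, c ∈ B: (1) β(a)•(b•c) = (a•b)•α(c); (2) (a•b)•β(c) = β(a)•(b•β(α⁻¹(c))); (3) α(a)•(b★c) = (a•b)★(a^★ ★ (a•c)); (4) (b★c)•α(a) = ((b•a)★a^★)★(c•a), where x^★ denotes the inverse of x with respect to ★. -/
/-- A Hom-brace of type (1): `(B, ★, α)` is an abelian Hom-group (with unit `es`
and inverse `sinv`), `(B, •, β)` is a Hom-group (with unit `ed` and inverse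
`dinv`), `β` is a `★`-homomorphism commuting with `α`, `α` is `•`-multiplicative,
and the two twisted brace distributivity laws hold. -/
def IsHomBrace1 {B : Type*} (star mul : B → B → B) (es : B) (sinv : B → B)
    (ed : B) (dinv : B → B) (α β : B ≃ B) : Prop :=
  IsHomGroup star es sinv α ∧
  (∀ a b, star a b = star b a) ∧
  IsHomGroup mul ed dinv β ∧
  (∀ a b, β (star a b) = star (β a) (β b)) ∧
  (∀ a, α (β a) = β (α a)) ∧
  (∀ a b, α (mul a b) = mul (α a) (α b)) ∧
  (∀ a b c, mul (α a) (star b c) = star (mul a b) (star (sinv a) (mul a c))) ∧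
  (∀ a b c, mul (star b c) (α a) = star (star (mul b a) (sinv a)) (mul c a))

/-- A Hom-brace of type (2). -/
def IsHomBrace2 {B : Type*} (star mul : B → B → B) (es : B) (sinv : B → B)
    (ed : B) (dinv : B → B) (α β : B ≃ B) : Prop :=
  IsHomGroup star es sinv α ∧
  (∀ a b, star a b = star b a) ∧
  IsHomGroup mul ed dinv β ∧
  (∀ a b c, mul (β (α (α a))) (mul (β (α b)) (β (β c)))
    = mul (mul (α (α a)) (β (α b))) (β (β (α c)))) ∧
  (∀ a b, β (star a b) = star (β a) (β b)) ∧
  (∀ a, α (β a) = β (α a)) ∧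
  (∀ a b, α (mul a b) = mul (α a) (α b)) ∧
  (∀ a b c, mul (α (α a)) (β (star b c))
    = star (mul (α a) (β b)) (star (α (sinv a)) (mul (α a) (β c)))) ∧
  (∀ a b c, mul (α (star b c)) (α (β a))
    = star (star (mul (α b) (β a)) (α (sinv a))) (mul (α c) (β a)))

namespace IsHomGroup

variable {G : Type*} {mul : G → G → G} {e : G} {inv : G → G} {α : G ≃ G}

theorem eq_inv_of_mul_eq (h : IsHomGroup mul e inv α) {x y : G} (hxy : mul x y = e) :
    y = inv x := by
  obtain ⟨assoc, -, mul_e, e_mul, -, inv_mul⟩ := h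
  have key := assoc (inv x) x y
  rw [hxy, mul_e, inv_mul, e_mul] at key
  exact (α.injective (α.injective key)).symm

theorem map_inv (h : IsHomGroup mul e inv α) (x : G) : α (inv x) = inv (α x) := by
  apply h.eq_inv_of_mul_eq
  rw [← h.2.1, h.2.2.2.2.1, h.map_unit]

end IsHomGroup

/-- Identities satisfied in any Hom-brace of type (2). -/
theorem stmt_14 {B : Type*} (star mul : B → B → B) (es : B) (sinv : B → B)
    (ed : B) (dinv : B → B) (α β : B ≃ B)
    (h : IsHomBrace2 star mul es sinv ed dinv α β) :
    (∀ a b c, mul (β a) (mul b c) = mul (mul a b) (α c)) ∧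
    (∀ a b c, mul (mul a b) (β c) = mul (β a) (mul b (β (α.symm c)))) ∧
    (∀ a b c, mul (α a) (star b c) = star (mul a b) (star (sinv a) (mul a c))) ∧
    (∀ a b c, mul (star b c) (α a) = star (star (mul b a) (sinv a)) (mul c a)) := by
  obtain ⟨hstar, -, hmul, hassoc, hβstar, hαβ, -, hleft, hright⟩ := h
  have assoc : ∀ a b c, mul (β a) (mul b c) = mul (mul a b) (α c) := by
    intro a b c
    obtain ⟨a, rfl⟩ := α.surjective a
    obtain ⟨a, rfl⟩ := α.surjective a
    obtain ⟨b, rfl⟩ := β.surjective b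
    obtain ⟨b, rfl⟩ := α.surjective b
    obtain ⟨c, rfl⟩ := β.surjective c
    obtain ⟨c, rfl⟩ := β.surjective c
    rw [hassoc, hαβ, hαβ]
  have twist_eq : ∀ c, α c = β c := by
    intro c
    have key := (assoc ed (dinv ed) c).symm.trans (hmul.1 ed (dinv ed) c)
    rw [hmul.2.2.2.2.1, hmul.2.2.2.1, hmul.2.2.2.1] at key
    exact β.injective key
  refine ⟨assoc, fun a b c => ?_, fun a b c => ?_, fun a b c => ?_⟩
  · rw [assoc, hαβ, α.apply_symm_apply]
  · obtain ⟨a, rfl⟩ := α.surjective a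
    obtain ⟨b, rfl⟩ := β.surjective b
    obtain ⟨c, rfl⟩ := β.surjective c
    rw [← hβstar, hleft, hstar.map_inv]
  · obtain ⟨a, rfl⟩ := β.surjective a
    obtain ⟨b, rfl⟩ := α.surjective b
    obtain ⟨c, rfl⟩ := α.surjective c
    rw [← hstar.2.1, hright, hstar.map_inv, twist_eq a]
end

section
/- Let B be a set with two binary operations ★, • and a bijective map α : B → B. Then (B, ★, •, α, α) is a Hom-brace of type (1) with β = α if and only if (B, ★, •, α, α) is a Hom-brace of type (2) with β = α. -/
/-- An α-Hom-brace of type (1) is the same as an α-Hom-brace of type (2). -/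
theorem stmt_15 {B : Type*} (star mul : B → B → B) (es : B) (sinv : B → B)
    (ed : B) (dinv : B → B) (α : B ≃ B) :
    IsHomBrace1 star mul es sinv ed dinv α α ↔
      IsHomBrace2 star mul es sinv ed dinv α α := by
  constructor
  · rintro ⟨hs, hcomm, hm, hβ, hαβ, hα, hl, hr⟩
    refine ⟨hs, hcomm, hm, fun a b c => hm.1 _ _ _, hβ, hαβ, hα, fun a b c => ?_, fun a b c => ?_⟩
    · simp only [← hα, ← hβ, hl]
    · simp only [← hα, ← hβ, hr]
  · rintro ⟨hs, hcomm, hm, -, hβ, hαβ, hα, hl, hr⟩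
    refine ⟨hs, hcomm, hm, hβ, hαβ, hα, fun a b c => α.injective ?_, fun a b c => α.injective ?_⟩
    · simpa only [← hα, ← hβ] using hl a b c
    · simpa only [← hα, ← hβ] using hr a b c
end
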